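/- Let σ be a type of edge labels, let n ≥ 1, and let the vertex set be {0, 1, …, n−1} with its natural linear order. Let A : σ → V → V → Prop be a labeled edge relation such that (i) every edge joins consecutive vertices: A R a b implies b = a + 1 or a = b + 1; and (ii) between any two vertices there is at most one labeled edge in either direction: if A R a b and A R' a' b' with {a, b} = {a', b'} as unordered pairs, then R = R' and (a, b) = (a', b'). Then every label R has the X̲-property with respect to the natural order: for all vertices n₀ < n₁ and n₂ < n₃, if A R n₀ n₃ and A R n₁ n₂, then A R n₀ n₂. -/

import Mathlib

/-- A labeled two-way path (edges only between consecutive vertices of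
`{0, …, n-1}`, with at most one labeled edge in either direction between any two
vertices) has the X̲-property with respect to the natural order, for every label. -/
theorem stmt_13 {σ : Type} {n : ℕ} (hn : 1 ≤ n)
    (A : σ → Fin n → Fin n → Prop)
    (hcons : ∀ (R : σ) (a b : Fin n), A R a b → (b : ℕ) = (a : ℕ) + 1 ∨ (a : ℕ) = (b : ℕ) + 1)
    (huniq : ∀ (R R' : σ) (a b a' b' : Fin n), A R a b → A R' a' b' →
        ((a = a' ∧ b = b') ∨ (a = b' ∧ b = a')) → R = R' ∧ a = a' ∧ b = b') :
    ∀ (R : σ) (n₀ n₁ n₂ n₃ : Fin n), n₀ < n₁ → n₂ < n₃ →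
      A R n₀ n₃ → A R n₁ n₂ → A R n₀ n₂ := by
  intro R n₀ n₁ n₂ n₃ h₀₁ h₂₃ hA hB
  have h₁ := hcons R n₀ n₃ hA
  have h₂ := hcons R n₁ n₂ hB
  rw [Fin.lt_def] at h₀₁ h₂₃
  have h₀₂ : n₀ = n₂ := Fin.ext (by omega)
  have h₃₁ : n₃ = n₁ := Fin.ext (by omega)
  have h := (huniq R R n₀ n₃ n₁ n₂ hA hB (Or.inr ⟨h₀₂, h₃₁⟩)).2.1
  rw [h] at h₀₁
  exact absurd h₀₁ (lt_irrefl _)
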